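/- arXiv:1802.09592 — 4 statements merged into one kernel-verified Lean document; each statement's English description precedes it below -/
import Mathlib

section
/- Consider the problem of minimizing x² + y² subject to xy = 1, with augmented Lagrangian L(x,y,w) = x² + y² + w(xy − 1) + (ρ/2)(xy − 1)² for a penalty parameter ρ > 0. Let (x_k), (y_k), (w_k) be real sequences such that for every k: x_{k+1} minimizes x ↦ L(x, y_k, w_k) over ℝ, y_{k+1} minimizes y ↦ L(x_{k+1}, y, w_k) over ℝ, and w_{k+1} = w_k + ρ(x_{k+1} y_{k+1} − 1). If there exists an index K with y_K = 0 or w_K = ρ, then x_j = 0 and y_j = 0 for all j > K, w_{j+1} = w_j − ρ for all j ≥ K, and consequently w_j → −∞ as j → ∞. -/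
/-- ADMM on `min {x² + y² : xy = 1}`: if at some iteration `y_K = 0` or `w_K = ρ`,
then all subsequent primal iterates are `(0,0)`, the multiplier decreases by `ρ`
each iteration, and `w_k → -∞`. -/
theorem stmt_0 (ρ : ℝ) (hρ : 0 < ρ)
    (L : ℝ → ℝ → ℝ → ℝ)
    (hL : ∀ x y w, L x y w = x ^ 2 + y ^ 2 + w * (x * y - 1) + (ρ / 2) * (x * y - 1) ^ 2)
    (x y w : ℕ → ℝ)
    (hx : ∀ k, ∀ t : ℝ, L (x (k + 1)) (y k) (w k) ≤ L t (y k) (w k))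
    (hy : ∀ k, ∀ t : ℝ, L (x (k + 1)) (y (k + 1)) (w k) ≤ L (x (k + 1)) t (w k))
    (hw : ∀ k, w (k + 1) = w k + ρ * (x (k + 1) * y (k + 1) - 1))
    (K : ℕ) (hK : y K = 0 ∨ w K = ρ) :
    (∀ j, K < j → x j = 0 ∧ y j = 0) ∧
    (∀ j, K ≤ j → w (j + 1) = w j - ρ) ∧
    Filter.Tendsto w Filter.atTop Filter.atBot := by
  have step_zero : ∀ k, y k = 0 ∨ w k = ρ →
      x (k + 1) = 0 ∧ y (k + 1) = 0 ∧ w (k + 1) = w k - ρ := by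
    intro k hk
    have hyw : (w k - ρ) * y k = 0 := by
      rcases hk with h | h <;> simp [h]
    have hx0 : x (k + 1) = 0 := by
      have h := hx k 0
      rw [hL, hL] at h
      have hprod : x (k + 1) * ((w k - ρ) * y k) = 0 := by rw [hyw, mul_zero]
      have hnonneg : 0 ≤ ρ * (x (k + 1) * y k) ^ 2 := by positivity
      exact pow_eq_zero_iff two_ne_zero |>.mp (le_antisymm (by linarith) (sq_nonneg _))
    have hy0 : y (k + 1) = 0 := by
      have h := hy k 0
      rw [hL, hL, hx0] at h
      exact pow_eq_zero_iff two_ne_zero |>.mp (le_antisymm (by linarith) (sq_nonneg _))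
    refine ⟨hx0, hy0, ?_⟩
    rw [hw, hx0]
    ring
  have hcond : ∀ j, K ≤ j → y j = 0 ∨ w j = ρ := by
    intro j hj
    induction j, hj using Nat.le_induction with
    | base => exact hK
    | succ j _ ih => exact Or.inl (step_zero j ih).2.1
  have hdecr : ∀ j, K ≤ j → w (j + 1) = w j - ρ := fun j hj => (step_zero j (hcond j hj)).2.2
  refine ⟨fun j hj => ?_, hdecr, ?_⟩
  · obtain ⟨i, rfl⟩ := Nat.exists_eq_succ_of_ne_zero (Nat.ne_zero_of_lt hj)
    have h := step_zero i (hcond i (Nat.lt_succ_iff.mp hj))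
    exact ⟨h.1, h.2.1⟩
  · have hclosed : ∀ n : ℕ, w (n + K) = w K + -((n : ℝ) * ρ) := by
      intro n
      induction n with
      | zero => simp
      | succ n ih =>
        rw [Nat.add_right_comm, hdecr _ (Nat.le_add_left K n), ih]
        push_cast
        ring
    rw [← Filter.tendsto_add_atTop_iff_nat K]
    simp only [hclosed]
    exact Filter.tendsto_atBot_add_const_left _ _ (Filter.tendsto_neg_atTop_atBot.comp
      (tendsto_natCast_atTop_atTop.atTop_mul_const hρ))
end

section
/- Let A be a nonzero real m × n matrix and let b, c ∈ ℝᵐ lie in the column space of A. Then for every x ∈ ℝⁿ with Ax = b, there exists x′ ∈ ℝⁿ with Ax′ = c and ‖x − x′‖ ≤ λ₊₊(AAᵀ)^{−1/2} ‖b − c‖; in particular the distance between the affine solution sets {x : Ax = b} and {x : Ax = c} is at most λ₊₊(AAᵀ)^{−1/2}‖b − c‖. -/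
open Matrix

/-- A real Gram matrix `AᵀA` is orthogonally diagonalizable with nonnegative eigenvalues. -/
theorem Matrix.exists_orthogonal_diagonalization_transpose_mul_self {m n : ℕ}
    (A : Matrix (Fin m) (Fin n) ℝ) :
    ∃ (U : Matrix (Fin n) (Fin n) ℝ) (d : Fin n → ℝ), Uᵀ * U = 1 ∧ U * Uᵀ = 1 ∧
      (Aᵀ * A) * U = U * diagonal d ∧ ∀ i, 0 ≤ d i := by
  have hS : (Aᵀ * A).PosSemidef := by
    simpa using posSemidef_conjTranspose_mul_self A
  have hH := hS.isHermitian
  have hU : (hH.eigenvectorUnitary : Matrix (Fin n) (Fin n) ℝ)ᵀ * hH.eigenvectorUnitary = 1 := by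
    simpa [star_eq_conjTranspose] using Unitary.coe_star_mul_self hH.eigenvectorUnitary
  refine ⟨hH.eigenvectorUnitary, hH.eigenvalues, hU, mul_eq_one_comm.mp hU, ?_,
    hS.eigenvalues_nonneg⟩
  ext i j
  rw [mul_diagonal, mul_comm]
  exact congrFun (hH.mulVec_eigenvectorBasis j) i

/-- A positive eigenvalue of `AᵀA` is an eigenvalue of `AAᵀ`. -/
theorem Matrix.exists_eigenvector_mul_transpose_self {m n : ℕ} (A : Matrix (Fin m) (Fin n) ℝ)
    {u : Fin n → ℝ} (hu : u ≠ 0) {μ : ℝ} (hμ : μ ≠ 0) (h : (Aᵀ * A) *ᵥ u = μ • u) :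
    ∃ v : Fin m → ℝ, v ≠ 0 ∧ (A * Aᵀ) *ᵥ v = μ • v := by
  refine ⟨A *ᵥ u, fun h0 => ?_, ?_⟩
  · rw [← mulVec_mulVec, h0, mulVec_zero] at h
    exact smul_ne_zero hμ hu h.symm
  · rw [mulVec_mulVec, Matrix.mul_assoc, ← mulVec_mulVec, h, mulVec_smul]

/-- If all positive eigenvalues of `AAᵀ` are at least `lam`, then every vector in the range of `A`
has a preimage `w` with `lam ‖w‖² ≤ ‖Aw‖²`. -/
theorem Matrix.exists_mulVec_eq_and_mul_dotProduct_self_le {m n : ℕ}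
    (A : Matrix (Fin m) (Fin n) ℝ) (lam : ℝ)
    (hmin : ∀ μ : ℝ, 0 < μ → (∃ v : Fin m → ℝ, v ≠ 0 ∧ (A * Aᵀ) *ᵥ v = μ • v) → lam ≤ μ)
    (z : Fin n → ℝ) :
    ∃ w : Fin n → ℝ, A *ᵥ w = A *ᵥ z ∧ lam * (w ⬝ᵥ w) ≤ (A *ᵥ w) ⬝ᵥ (A *ᵥ w) := by
  obtain ⟨U, d, hU, hU', hd, hd0⟩ := A.exists_orthogonal_diagonalization_transpose_mul_self
  have hlam : ∀ i, d i ≠ 0 → lam ≤ d i := by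
    intro i hi
    refine hmin _ (lt_of_le_of_ne (hd0 i) hi.symm)
      (A.exists_eigenvector_mul_transpose_self (u := U *ᵥ Pi.single i 1) ?_ hi ?_)
    · intro h0
      have h1 : (Pi.single i 1 : Fin n → ℝ) = 0 := by
        rw [← one_mulVec (Pi.single i 1), ← hU, ← mulVec_mulVec, h0, mulVec_zero]
      simpa using congrFun h1 i
    · rw [mulVec_mulVec, hd, ← mulVec_mulVec, diagonal_mulVec_single, ← mulVec_smul]
      congr 1
      ext k
      simp [Pi.single_apply]
  have hdot (x y : Fin n → ℝ) : (U *ᵥ x) ⬝ᵥ (U *ᵥ y) = x ⬝ᵥ y := by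
    rw [dotProduct_mulVec, ← mulVec_transpose, mulVec_mulVec, hU, one_mulVec]
  have hgram (y : Fin n → ℝ) : (Aᵀ * A) *ᵥ (U *ᵥ y) = U *ᵥ (diagonal d *ᵥ y) := by
    rw [mulVec_mulVec, hd, ← mulVec_mulVec]
  set y := Uᵀ *ᵥ z with hy
  have hz : z = U *ᵥ y := by rw [hy, mulVec_mulVec, hU', one_mulVec]
  let a : Fin n → ℝ := fun i => if d i = 0 then 0 else y i
  refine ⟨U *ᵥ a, ?_, ?_⟩
  · have hker : (Aᵀ * A) *ᵥ (U *ᵥ a - z) = 0 := by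
      have hda : diagonal d *ᵥ a = diagonal d *ᵥ y := by
        ext i
        by_cases hi : d i = 0 <;> simp [mulVec_diagonal, a, hi]
      rw [mulVec_sub, hz, hgram, hgram, hda, sub_self]
    have := (conjTranspose_mul_self_mulVec_eq_zero A (U *ᵥ a - z)).mp (by simpa using hker)
    rwa [mulVec_sub, sub_eq_zero] at this
  · rw [hdot, dotProduct_mulVec (A *ᵥ _), ← mulVec_transpose, mulVec_mulVec, hgram, hdot]
    simp only [dotProduct, Finset.mul_sum]
    refine Finset.sum_le_sum fun i _ => ?_
    rw [mulVec_diagonal]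
    by_cases hi : d i = 0
    · simp [a, hi]
    · nlinarith [hlam i hi, mul_self_nonneg (a i)]

/-- If `b, c` lie in the column space of a nonzero matrix `A` and `lam` is the smallest
positive eigenvalue of `AAᵀ`, then every solution of `Ax = b` is within (Euclidean)
distance `lam^{-1/2} ‖b − c‖` of some solution of `Ax′ = c`. -/
theorem stmt_8 {m n : ℕ} (A : Matrix (Fin m) (Fin n) ℝ) (hA : A ≠ 0)
    (b c : Fin m → ℝ) (hb : b ∈ Set.range A.mulVec) (hc : c ∈ Set.range A.mulVec)
    (lam : ℝ) (hpos : 0 < lam)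
    (heig : ∃ v : Fin m → ℝ, v ≠ 0 ∧ (A * Aᵀ) *ᵥ v = lam • v)
    (hmin : ∀ μ : ℝ, 0 < μ → (∃ v : Fin m → ℝ, v ≠ 0 ∧ (A * Aᵀ) *ᵥ v = μ • v) → lam ≤ μ) :
    ∀ x : Fin n → ℝ, A *ᵥ x = b →
      ∃ x' : Fin n → ℝ, A *ᵥ x' = c ∧
        Real.sqrt ((x - x') ⬝ᵥ (x - x')) ≤
          Real.sqrt lam⁻¹ * Real.sqrt ((b - c) ⬝ᵥ (b - c)) := by
  rintro x rfl
  obtain ⟨t, rfl⟩ := hc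
  obtain ⟨w, hw, hle⟩ := A.exists_mulVec_eq_and_mul_dotProduct_self_le lam hmin (x - t)
  rw [mulVec_sub] at hw
  refine ⟨x - w, ?_, ?_⟩
  · rw [mulVec_sub, hw, sub_sub_cancel]
  · rw [sub_sub_cancel, ← hw, ← Real.sqrt_mul (inv_nonneg.mpr hpos.le)]
    exact Real.sqrt_le_sqrt ((le_inv_mul_iff₀ hpos).mpr hle)
end

section
/- Let H be a finite-dimensional real inner product space, let g : H → ℝ be (m,M)-strongly convex with 0 < m ≤ M and condition number κ = M/m, and let C ⊆ H be a nonempty closed convex set. For a, b ∈ H set C₁ = a + C and C₂ = b + C, and let δ = ‖b − a‖. Suppose x* ∈ C₁ satisfies g(x*) ≤ g(x) for all x ∈ C₁, and y* ∈ C₂ satisfies g(y*) ≤ g(y) for all y ∈ C₂. Then ‖x* − y*‖ ≤ (1 + 2κ)δ. -/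
open scoped RealInnerProductSpace

/-- First-order optimality: at a minimizer `x` of `g` over a convex set `s`, the gradient pairs
nonnegatively with every direction `y - x` pointing into `s`. -/
theorem IsMinOn.inner_gradient_nonneg {H : Type*} [NormedAddCommGroup H] [InnerProductSpace ℝ H]
    [CompleteSpace H] {g : H → ℝ} {s : Set H} {x y : H} (hmin : IsMinOn g s x)
    (hs : Convex ℝ s) (hg : DifferentiableAt ℝ g x) (hx : x ∈ s) (hy : y ∈ s) :
    0 ≤ ⟪gradient g x, y - x⟫ := by
  have h := hmin.localize.hasFDerivWithinAt_nonneg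
    hg.hasGradientAt.hasFDerivAt.hasFDerivWithinAt
    (sub_mem_posTangentConeAt_of_segment_subset (hs.segment_subset hx hy))
  simpa using h

/-- If `g` is `(m,M)`-strongly convex and `x*`, `y*` minimize `g` over the translates
`a + C` and `b + C` of a nonempty closed convex set `C`, then
`‖x* − y*‖ ≤ (1 + 2κ)‖b − a‖` where `κ = M/m`. -/
theorem stmt_9 {H : Type*}
    [NormedAddCommGroup H] [InnerProductSpace ℝ H] [FiniteDimensional ℝ H]
    (g : H → ℝ) (m M : ℝ) (hm : 0 < m) (hmM : m ≤ M)
    (hconv : ConvexOn ℝ Set.univ g)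
    (hdiff : Differentiable ℝ g)
    (hlip : ∀ x y : H, ‖gradient g x - gradient g y‖ ≤ M * ‖x - y‖)
    (hsc : ∀ x y : H, g x + ⟪gradient g x, y - x⟫ + (m / 2) * ‖y - x‖ ^ 2 ≤ g y)
    (C : Set H) (hCne : C.Nonempty) (hCcl : IsClosed C) (hCcv : Convex ℝ C)
    (a b xs ys : H)
    (hx₁ : xs ∈ (a + ·) '' C) (hxmin : ∀ x ∈ (a + ·) '' C, g xs ≤ g x)
    (hy₁ : ys ∈ (b + ·) '' C) (hymin : ∀ y ∈ (b + ·) '' C, g ys ≤ g y) :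
    ‖xs - ys‖ ≤ (1 + 2 * (M / m)) * ‖b - a‖ := by
  obtain ⟨p, hp, rfl⟩ := hx₁
  obtain ⟨q, hq, rfl⟩ := hy₁
  have hcv (c : H) : Convex ℝ ((c + ·) '' C) := hCcv.translate c
  have h₁ := IsMinOn.inner_gradient_nonneg (isMinOn_iff.2 hxmin) (hcv a) (hdiff _)
    ⟨p, hp, rfl⟩ ⟨q, hq, rfl⟩
  have h₂ := IsMinOn.inner_gradient_nonneg (isMinOn_iff.2 hymin) (hcv b) (hdiff _)
    ⟨q, hq, rfl⟩ ⟨p, hp, rfl⟩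
  have s₁ := hsc (a + p) (b + q)
  have s₂ := hsc (b + q) (a + p)
  have hl := hlip (a + p) (b + q)
  have hcs := abs_real_inner_le_norm (gradient g (a + p) - gradient g (b + q)) (b - a)
  beta_reduce at h₁ h₂ ⊢
  rw [norm_sub_rev (b + q)] at s₁
  rw [add_sub_add_left_eq_sub] at h₁ h₂
  set u := gradient g (a + p)
  set v := gradient g (b + q)
  set r := ‖(a + p) - (b + q)‖
  have hr0 : 0 ≤ r := norm_nonneg _
  have hd0 : 0 ≤ ‖b - a‖ := norm_nonneg _
  have e : ⟪u, b + q - (a + p)⟫ + ⟪v, a + p - (b + q)⟫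
      = ⟪u - v, b - a⟫ + ⟪u, q - p⟫ + ⟪v, p - q⟫ := by
    simp only [inner_sub_left, inner_sub_right, inner_add_right]
    ring
  have hmr : m * r * r ≤ M * ‖b - a‖ * r := by
    nlinarith [neg_le_of_abs_le hcs, mul_le_mul_of_nonneg_right hl hd0]
  have hbound : r ≤ M / m * ‖b - a‖ := by
    rw [div_mul_eq_mul_div, le_div_iff₀ hm]
    rcases hr0.eq_or_lt with h0 | hpos
    · rw [← h0, zero_mul]
      exact mul_nonneg (hm.le.trans hmM) hd0
    · linarith [le_of_mul_le_mul_right hmr hpos]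
  have hκ : 0 ≤ M / m * ‖b - a‖ := hr0.trans hbound
  linarith
end

section
/- Let Q be a nonzero real m × n matrix and let g : ℝⁿ → ℝ be differentiable with M-Lipschitz gradient. Suppose w, w′ ∈ ℝᵐ and z, z′ ∈ ℝⁿ satisfy Qᵀw = −∇g(z), Qᵀw′ = −∇g(z′), and w′ − w lies in the column space of Q. Then ‖w − w′‖² ≤ M² λ₊₊(QᵀQ)⁻¹ ‖z − z′‖². -/
open Matrix

/-- Parseval's identity in an eigenbasis of a real symmetric matrix. -/
theorem Matrix.IsHermitian.dotProduct_eq_sum_eigenvectorBasis {n : Type*} [Fintype n]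
    [DecidableEq n] {A : Matrix n n ℝ} (hA : A.IsHermitian) (x y : n → ℝ) :
    x ⬝ᵥ y = ∑ i, ((hA.eigenvectorBasis i).ofLp ⬝ᵥ x) * ((hA.eigenvectorBasis i).ofLp ⬝ᵥ y) := by
  have h := hA.eigenvectorBasis.sum_inner_mul_inner (WithLp.toLp 2 x) (WithLp.toLp 2 y)
  simp only [EuclideanSpace.inner_eq_star_dotProduct, star_trivial] at h
  rw [dotProduct_comm x y, ← h]
  exact Finset.sum_congr rfl fun i _ => by rw [dotProduct_comm y]

/-- If `lam` bounds the positive eigenvalues of a positive semidefinite `A` from below, then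
`lam • A ≤ A * A` as quadratic forms. -/
theorem Matrix.PosSemidef.mul_dotProduct_mulVec_le {n : Type*} [Fintype n] [DecidableEq n]
    {A : Matrix n n ℝ} (hA : A.PosSemidef) {lam : ℝ}
    (hmin : ∀ μ : ℝ, 0 < μ → (∃ v : n → ℝ, v ≠ 0 ∧ A *ᵥ v = μ • v) → lam ≤ μ) (x : n → ℝ) :
    lam * (x ⬝ᵥ A *ᵥ x) ≤ (A *ᵥ x) ⬝ᵥ (A *ᵥ x) := by
  have hH := hA.isHermitian
  have hcoord (i : n) : (hH.eigenvectorBasis i).ofLp ⬝ᵥ A *ᵥ x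
      = hH.eigenvalues i * ((hH.eigenvectorBasis i).ofLp ⬝ᵥ x) := by
    have hT : Aᵀ = A := by simpa [conjTranspose_eq_transpose_of_trivial] using hH.eq
    rw [dotProduct_mulVec, ← mulVec_transpose, hT, hH.mulVec_eigenvectorBasis,
      smul_dotProduct, smul_eq_mul]
  rw [hH.dotProduct_eq_sum_eigenvectorBasis x, hH.dotProduct_eq_sum_eigenvectorBasis (A *ᵥ x),
    Finset.mul_sum]
  refine Finset.sum_le_sum fun i _ => ?_
  rw [hcoord]
  set c := (hH.eigenvectorBasis i).ofLp ⬝ᵥ x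
  have hlam : lam * hH.eigenvalues i ≤ hH.eigenvalues i * hH.eigenvalues i := by
    rcases (hA.eigenvalues_nonneg i).eq_or_lt with h0 | h0
    · simp [← h0]
    · refine mul_le_mul_of_nonneg_right (hmin _ h0 ⟨(hH.eigenvectorBasis i).ofLp, ?_,
        hH.mulVec_eigenvectorBasis i⟩) h0.le
      intro hz
      exact hH.eigenvectorBasis.toBasis.ne_zero i (by
        rw [OrthonormalBasis.coe_toBasis]
        exact (WithLp.ofLp_eq_zero 2).1 hz)
  nlinarith [mul_le_mul_of_nonneg_right hlam (mul_self_nonneg c)]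

open Matrix

/-- If `g` has `M`-Lipschitz gradient `G`, `Qᵀw = −∇g(z)`, `Qᵀw′ = −∇g(z′)`, and
`w′ − w` lies in the column space of `Q`, then
`‖w − w′‖² ≤ M² λ₊₊(QᵀQ)⁻¹ ‖z − z′‖²` (squared Euclidean norms via dot products),
where `lam = λ₊₊(QᵀQ)` is the smallest positive eigenvalue of `QᵀQ`. -/
theorem stmt_16 {m n : ℕ} (Q : Matrix (Fin m) (Fin n) ℝ) (hQ : Q ≠ 0)
    (g : (Fin n → ℝ) → ℝ) (G : (Fin n → ℝ) → (Fin n → ℝ)) (M : ℝ)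
    (hg : Differentiable ℝ g)
    (hgrad : ∀ z v : Fin n → ℝ, fderiv ℝ g z v = G z ⬝ᵥ v)
    (hlip : ∀ z z' : Fin n → ℝ,
      Real.sqrt ((G z - G z') ⬝ᵥ (G z - G z')) ≤ M * Real.sqrt ((z - z') ⬝ᵥ (z - z')))
    (lam : ℝ) (hpos : 0 < lam)
    (heig : ∃ v : Fin n → ℝ, v ≠ 0 ∧ (Qᵀ * Q) *ᵥ v = lam • v)
    (hmin : ∀ μ : ℝ, 0 < μ → (∃ v : Fin n → ℝ, v ≠ 0 ∧ (Qᵀ * Q) *ᵥ v = μ • v) → lam ≤ μ)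
    (w w' : Fin m → ℝ) (z z' : Fin n → ℝ)
    (hw : Qᵀ *ᵥ w = -(G z)) (hw' : Qᵀ *ᵥ w' = -(G z'))
    (hrange : w' - w ∈ Set.range Q.mulVec) :
    (w - w') ⬝ᵥ (w - w') ≤ M ^ 2 * lam⁻¹ * ((z - z') ⬝ᵥ (z - z')) := by
  obtain ⟨x, hx⟩ := hrange
  have hPSD : (Qᵀ * Q).PosSemidef := by
    simpa [conjTranspose_eq_transpose_of_trivial] using posSemidef_conjTranspose_mul_self Q
  have hspec := hPSD.mul_dotProduct_mulVec_le hmin x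
  have hA : (Qᵀ * Q) *ᵥ x = G z - G z' := by
    rw [← mulVec_mulVec, show Q *ᵥ x = w' - w from hx, mulVec_sub, hw, hw']
    abel
  have hnorm : x ⬝ᵥ (Qᵀ * Q) *ᵥ x = (w - w') ⬝ᵥ (w - w') := by
    rw [← mulVec_mulVec, dotProduct_mulVec, vecMul_transpose,
      show Q *ᵥ x = w' - w from hx, ← neg_sub w w', neg_dotProduct_neg]
  rw [hnorm, hA] at hspec
  have hnonneg {k : ℕ} (v : Fin k → ℝ) : 0 ≤ v ⬝ᵥ v :=
    Finset.sum_nonneg fun i _ => mul_self_nonneg (v i)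
  have hL := pow_le_pow_left₀ (Real.sqrt_nonneg _) (hlip z z') 2
  rw [mul_pow, Real.sq_sqrt (hnonneg _), Real.sq_sqrt (hnonneg _)] at hL
  rw [mul_right_comm, ← div_eq_mul_inv, le_div_iff₀ hpos, mul_comm]
  exact hspec.trans hL
end
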